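/- Let h(k) be the number of pairs (a,b) of nonnegative integers with 4a+6b=k (so h(k)=0 for k<0), and set χ(k) = h(k) − h(−10−k) for k ∈ ℤ. Then in the formal power series ring ℤ[[q,q₁]], the series F = ∑_{d,d₁≥0} χ(d₁−d) q^d q₁^{d₁} satisfies F·(1−qq₁)(1−q^4)(1−q^6)(1−q₁^4)(1−q₁^6) = (1−q^4)(1−q^6) − q^{10}(1−q₁^4)(1−q₁^6). -/

import Mathlib

/-- `hInt k` is the number of pairs `(a, b)` of nonnegative integers with `4a + 6b = k`
(so `hInt k = 0` for `k < 0`). -/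
noncomputable def hInt (k : ℤ) : ℤ :=
  (Nat.card {p : ℕ × ℕ // 4 * (p.1 : ℤ) + 6 * (p.2 : ℤ) = k} : ℤ)

/-- `chiInt k = h(k) - h(-10 - k)`. -/
noncomputable def chiInt (k : ℤ) : ℤ := hInt k - hInt (-10 - k)

/-- The generating function `F = ∑_{d, d₁ ≥ 0} χ(d₁ - d) q^d q₁^{d₁}` in `ℤ[[q, q₁]]`,
where the variable `q` has index `0` and `q₁` has index `1`. -/
noncomputable def Fgen : MvPowerSeries (Fin 2) ℤ :=
  fun d => chiInt ((d 1 : ℤ) - (d 0 : ℤ))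

lemma hInt_neg (k : ℤ) (hk : k < 0) : hInt k = 0 := by
  unfold hInt
  have : IsEmpty {p : ℕ × ℕ // 4 * (p.1 : ℤ) + 6 * (p.2 : ℤ) = k} :=
    ⟨fun p => by have := p.2; omega⟩
  simp

/-- indicator of the nonnegative multiples of `6` -/
def gInt (k : ℤ) : ℤ := if 0 ≤ k ∧ k % 6 = 0 then 1 else 0

lemma hInt_rec (k : ℤ) : hInt k = hInt (k - 4) + gInt k := by
  have fin : ∀ k : ℤ, Finite {p : ℕ × ℕ // 4 * (p.1 : ℤ) + 6 * (p.2 : ℤ) = k} := by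
    intro k
    refine Set.Finite.to_subtype (s := {p : ℕ × ℕ | 4 * (p.1 : ℤ) + 6 * (p.2 : ℤ) = k}) ?_
    refine ((Set.finite_Iic k.toNat).prod (Set.finite_Iic k.toNat)).subset ?_
    rintro ⟨a, b⟩ h
    simp only [Set.mem_ofPred_eq, Set.mem_prod, Set.mem_Iic] at h ⊢
    omega
  have e : {p : ℕ × ℕ // 4 * (p.1 : ℤ) + 6 * (p.2 : ℤ) = k} ≃
      {p : ℕ × ℕ // 4 * (p.1 : ℤ) + 6 * (p.2 : ℤ) = k - 4} ⊕ {b : ℕ // 6 * (b : ℤ) = k} :=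
    { toFun := fun p => if h : p.1.1 = 0 then Sum.inr ⟨p.1.2, by have := p.2; omega⟩
        else Sum.inl ⟨(p.1.1 - 1, p.1.2), by have := p.2; simp only; omega⟩
      invFun := fun s => match s with
        | Sum.inl p => ⟨(p.1.1 + 1, p.1.2), by have := p.2; simp only; omega⟩
        | Sum.inr b => ⟨(0, b.1), by have := b.2; simp only; omega⟩
      left_inv := by
        rintro ⟨⟨a, b⟩, h⟩
        by_cases ha : a = 0
        · subst ha; simp
        · simp only [ha, dite_false]
          congr 2
          omega
      right_inv := by
        rintro (⟨⟨a, b⟩, h⟩ | ⟨b, h⟩) <;> simp }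
  have hg : (Nat.card {b : ℕ // 6 * (b : ℤ) = k} : ℤ) = gInt k := by
    unfold gInt
    split_ifs with h
    · have : Unique {b : ℕ // 6 * (b : ℤ) = k} :=
        { default := ⟨(k / 6).toNat, by omega⟩
          uniq := by rintro ⟨b, hb⟩; apply Subtype.ext; simp only; omega }
      simp
    · have : IsEmpty {b : ℕ // 6 * (b : ℤ) = k} := ⟨fun p => by have := p.2; omega⟩
      simp
  have := fin (k - 4)
  have := fin k
  have : Finite {b : ℕ // 6 * (b : ℤ) = k} :=
    Finite.of_injective (β := {p : ℕ × ℕ // 4 * (p.1 : ℤ) + 6 * (p.2 : ℤ) = k})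
      (fun b : {b : ℕ // 6 * (b : ℤ) = k} => ⟨(0, b.1), by have := b.2; simp only; omega⟩)
      (by rintro ⟨a, ha⟩ ⟨b, hb⟩ h; simpa using h)
  rw [← hg]
  unfold hInt
  rw [Nat.card_congr e, Nat.card_sum]
  push_cast
  rfl

/-- two-variable series from a coefficient function -/
def ser (f : ℕ → ℕ → ℤ) : MvPowerSeries (Fin 2) ℤ := fun d => f (d 0) (d 1)

lemma coeff_ser (f : ℕ → ℕ → ℤ) (d : Fin 2 →₀ ℕ) :
    MvPowerSeries.coeff d (ser f) = f (d 0) (d 1) := rfl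

lemma ser_mul_q (f : ℕ → ℕ → ℤ) (n : ℕ) : ser f * MvPowerSeries.X 0 ^ n =
    ser (fun a b => if n ≤ a then f (a - n) b else 0) := by
  ext d
  rw [MvPowerSeries.X_pow_eq, MvPowerSeries.coeff_mul_monomial, coeff_ser, coeff_ser]
  simp [Finsupp.single_le_iff]

lemma ser_mul_q1 (f : ℕ → ℕ → ℤ) (n : ℕ) : ser f * MvPowerSeries.X 1 ^ n =
    ser (fun a b => if n ≤ b then f a (b - n) else 0) := by
  ext d
  rw [MvPowerSeries.X_pow_eq, MvPowerSeries.coeff_mul_monomial, coeff_ser, coeff_ser]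
  simp [Finsupp.single_le_iff]

lemma ser_sub (f g : ℕ → ℕ → ℤ) : ser f - ser g = ser (fun a b => f a b - g a b) := rfl

lemma ser_one : (1 : MvPowerSeries (Fin 2) ℤ) =
    ser (fun a b => if a = 0 ∧ b = 0 then 1 else 0) := by
  ext d
  rw [MvPowerSeries.coeff_one, coeff_ser]
  congr 1
  simp [Finsupp.ext_iff, Fin.forall_fin_two]

lemma hInt_shift (n : ℕ) : hInt n - (if 4 ≤ n then hInt ((n - 4 : ℕ) : ℤ) else 0) = gInt n := by
  rw [hInt_rec]
  split_ifs with h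
  · push_cast [h]; ring
  · rw [hInt_neg _ (by omega)]; ring

lemma gInt_shift (n : ℕ) : gInt n - (if 6 ≤ n then gInt ((n - 6 : ℕ) : ℤ) else 0) =
    if n = 0 then 1 else 0 := by
  unfold gInt
  split_ifs <;> omega

lemma A_eq : ser (fun a b => if a = 0 then hInt b else 0) * (1 - MvPowerSeries.X 1 ^ 4) *
    (1 - MvPowerSeries.X 1 ^ 6) = 1 := by
  have h1 : ser (fun a b => if a = 0 then hInt b else 0) * (1 - MvPowerSeries.X 1 ^ 4) =
      ser (fun a b => if a = 0 then gInt b else 0) := by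
    rw [mul_sub, mul_one, ser_mul_q1, ser_sub]
    congr 1; funext a b
    by_cases ha : a = 0
    · simpa [ha] using hInt_shift b
    · simp [ha]
  rw [h1, mul_sub, mul_one, ser_mul_q1, ser_sub, ser_one]
  congr 1; funext a b
  by_cases ha : a = 0
  · simpa [ha] using gInt_shift b
  · simp [ha]

lemma B_eq : ser (fun a b => if b = 0 then hInt a else 0) * (1 - MvPowerSeries.X 0 ^ 4) *
    (1 - MvPowerSeries.X 0 ^ 6) = 1 := by
  have h1 : ser (fun a b => if b = 0 then hInt a else 0) * (1 - MvPowerSeries.X 0 ^ 4) =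
      ser (fun a b => if b = 0 then gInt a else 0) := by
    rw [mul_sub, mul_one, ser_mul_q, ser_sub]
    congr 1; funext a b
    by_cases hb : b = 0
    · simpa [hb] using hInt_shift a
    · simp [hb]
  rw [h1, mul_sub, mul_one, ser_mul_q, ser_sub, ser_one]
  congr 1; funext a b
  by_cases hb : b = 0
  · simpa [hb] using gInt_shift a
  · simp [hb]

lemma F_eq : Fgen * (1 - MvPowerSeries.X 0 * MvPowerSeries.X 1) =
    ser (fun a b => if a = 0 then hInt b else 0) -
    ser (fun a b => if b = 0 then hInt a else 0) * MvPowerSeries.X 0 ^ 10 := by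
  have hF : Fgen = ser (fun a b => chiInt ((b : ℤ) - a)) := rfl
  have e : Fgen * (1 - MvPowerSeries.X 0 * MvPowerSeries.X 1) =
      Fgen - Fgen * MvPowerSeries.X 0 ^ 1 * MvPowerSeries.X 1 ^ 1 := by ring
  rw [e, hF, ser_mul_q, ser_mul_q1, ser_mul_q, ser_sub, ser_sub]
  congr 1; funext a b
  rcases a with _ | a
  · have : hInt (-10 - (b : ℤ)) = 0 := hInt_neg _ (by omega)
    simp [chiInt, this]
  · rcases b with _ | b
    · have h0 : hInt (-1 + -(a : ℤ)) = 0 := hInt_neg _ (by omega)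
      have h2 : (-10 - (-1 + -(a : ℤ))) = (a : ℤ) + 1 - 10 := by ring
      by_cases h : 10 ≤ a + 1
      · have h3 : ((a - 9 : ℕ) : ℤ) = (a : ℤ) + 1 - 10 := by omega
        simp [chiInt, h0, h2, h, h3]
      · have h3 : hInt ((a : ℤ) + 1 - 10) = 0 := hInt_neg _ (by omega)
        simp [chiInt, h0, h2, h, h3]
    · simp

/-- `F · (1-qq₁)(1-q⁴)(1-q⁶)(1-q₁⁴)(1-q₁⁶) = (1-q⁴)(1-q⁶) - q¹⁰(1-q₁⁴)(1-q₁⁶)`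
in `ℤ[[q, q₁]]`. -/
theorem generating_function_X1_alternative_closed_form :
    letI q : MvPowerSeries (Fin 2) ℤ := MvPowerSeries.X 0
    letI q₁ : MvPowerSeries (Fin 2) ℤ := MvPowerSeries.X 1
    Fgen * (1 - q * q₁) * (1 - q ^ 4) * (1 - q ^ 6) * (1 - q₁ ^ 4) * (1 - q₁ ^ 6) =
      (1 - q ^ 4) * (1 - q ^ 6) - q ^ 10 * (1 - q₁ ^ 4) * (1 - q₁ ^ 6) := by
  set q : MvPowerSeries (Fin 2) ℤ := MvPowerSeries.X 0
  set q₁ : MvPowerSeries (Fin 2) ℤ := MvPowerSeries.X 1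
  have hF : Fgen * (1 - q * q₁) = _ := F_eq
  have hA : _ * (1 - q₁ ^ 4) * (1 - q₁ ^ 6) = 1 := A_eq
  have hB : _ * (1 - q ^ 4) * (1 - q ^ 6) = 1 := B_eq
  rw [hF]
  linear_combination (1 - q ^ 4) * (1 - q ^ 6) * hA - q ^ 10 * (1 - q₁ ^ 4) * (1 - q₁ ^ 6) * hB
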